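/- Let G^s be an SCG, t ∈ ℤ, γ ≥ 0 an integer, and X, Y ∈ V distinct with X an ancestor of Y in G^s. Assume: (i) γ = 0 or Cycles^>(X, G^s \ {Y}) = ∅; and (ii) there is no σ-active (given the empty set) backdoor path ⟨X, V^2, …, V^{n−1}, Y⟩ from X to Y in G^s with {V^2, …, V^{n−1}} ⊆ Desc(X, G^s). Then A_γ satisfies the backdoor criterion over all candidate FTCGs relative to ((X, t−γ), (Y, t)). (Graph-theoretic form of Lemma 2: P(y_t | do(x_{t−γ})) is identifiable by the adjustment set A_γ.) -/

import Mathlib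

/-- `u` is an ancestor of `v` (equivalently, `v` is a descendant of `u`):
there is a possibly empty directed path from `u` to `v` in the directed graph
with edge relation `E`. -/
def Anc {α : Type*} (E : α → α → Prop) (u v : α) : Prop :=
  Relation.ReflTransGen E u v

/-- A directed graph is acyclic if there is no nonempty directed path
from a vertex to itself. -/
def Acyclic {α : Type*} (E : α → α → Prop) : Prop :=
  ∀ v, ¬ Relation.TransGen E v v

/-- A path in a directed graph, given as a sequence of `n + 1` pairwise
distinct vertices `w 0, …, w n` (with `n ≥ 1`) together with a chosen
direction for each step: `dir i = true` means the chosen edge is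
`w i → w (i+1)`, and `dir i = false` means it is `w (i+1) → w i`. -/
structure DPath {α : Type*} (E : α → α → Prop) where
  n : ℕ
  pos : 1 ≤ n
  w : ℕ → α
  dir : ℕ → Bool
  inj : ∀ i j, i ≤ n → j ≤ n → w i = w j → i = j
  valid : ∀ i, i < n →
    (dir i = true → E (w i) (w (i + 1))) ∧ (dir i = false → E (w (i + 1)) (w i))

/-- The path runs between `u` and `v`. -/
def DPath.Between {α : Type*} {E : α → α → Prop} (π : DPath E) (u v : α) : Prop :=
  π.w 0 = u ∧ π.w π.n = v

/-- A backdoor path: the first chosen edge points into the first vertex. -/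
def DPath.Backdoor {α : Type*} {E : α → α → Prop} (π : DPath E) : Prop :=
  π.dir 0 = false

/-- The non-endpoint vertex at position `i` is a collider on the path:
both chosen edges at it point into it. -/
def DPath.ColliderAt {α : Type*} {E : α → α → Prop} (π : DPath E) (i : ℕ) : Prop :=
  0 < i ∧ i < π.n ∧ π.dir (i - 1) = true ∧ π.dir i = false

/-- The non-endpoint vertex at position `i` is a definite non-collider:
at least one of the two chosen edges at it points out of it. -/
def DPath.DefNonColliderAt {α : Type*} {E : α → α → Prop} (π : DPath E) (i : ℕ) : Prop :=
  0 < i ∧ i < π.n ∧ (π.dir (i - 1) = false ∨ π.dir i = true)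

/-- A set `Z` blocks a path if some definite non-collider on the path belongs
to `Z`, or some collider on the path has no descendant in `Z`. -/
def Blocks {α : Type*} {E : α → α → Prop} (Z : Set α) (π : DPath E) : Prop :=
  (∃ i, π.DefNonColliderAt i ∧ π.w i ∈ Z) ∨
  (∃ i, π.ColliderAt i ∧ ∀ z ∈ Z, ¬ Anc E (π.w i) z)

/-- Map a path along an inclusion of edge relations (same vertices, same
chosen directions). -/
def DPath.map {α : Type*} {E E' : α → α → Prop} (h : ∀ a b, E a b → E' a b)
    (π : DPath E) : DPath E' where
  n := π.n
  pos := π.pos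
  w := π.w
  dir := π.dir
  inj := π.inj
  valid := fun i hi =>
    ⟨fun hd => h _ _ ((π.valid i hi).1 hd), fun hd => h _ _ ((π.valid i hi).2 hd)⟩

/-- Temporal priority: every edge goes weakly forward in time, and strictly
forward between two instances of the same time series. -/
def TemporalPriority {V : Type*} (F : V × ℤ → V × ℤ → Prop) : Prop :=
  ∀ A B : V, ∀ s t : ℤ, F (A, s) (B, t) → s ≤ t ∧ (A = B → s < t)

/-- Maximal lag `γmax`: every edge has lag at most `γmax`. -/
def MaxLag {V : Type*} (γmax : ℤ) (F : V × ℤ → V × ℤ → Prop) : Prop :=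
  ∀ A B : V, ∀ s t : ℤ, F (A, s) (B, t) → t - s ≤ γmax

/-- Consistency throughout time: the edge relation is invariant under
simultaneous time shifts. -/
def ConsistentThroughTime {V : Type*} (F : V × ℤ → V × ℤ → Prop) : Prop :=
  ∀ A B : V, ∀ s t k : ℤ, F (A, s) (B, t) ↔ F (A, s + k) (B, t + k)

/-- The extended summary causal graph (ESCG) derived from an FTCG `F`:
vertices `Sum.inl A` represent `A_{t^-}` (past slice) and `Sum.inr A`
represent `A_t` (present slice). -/
def derivedESCG {V : Type*} (γmax : ℤ) (F : V × ℤ → V × ℤ → Prop) :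
    (V ⊕ V) → (V ⊕ V) → Prop
  | Sum.inr A, Sum.inr B => F (A, 0) (B, 0)
  | Sum.inl A, Sum.inr B => ∃ γ : ℤ, 1 ≤ γ ∧ γ ≤ γmax ∧ F (A, -γ) (B, 0)
  | _, _ => False

/-- A candidate FTCG for an ESCG `e`: an FTCG satisfying temporal priority,
maximal lag `γmax`, consistency throughout time and acyclicity whose derived
ESCG is `e`. -/
def CandidateESCG {V : Type*} (γmax : ℤ) (e : (V ⊕ V) → (V ⊕ V) → Prop)
    (F : V × ℤ → V × ℤ → Prop) : Prop :=
  TemporalPriority F ∧ MaxLag γmax F ∧ ConsistentThroughTime F ∧ Acyclic F ∧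
    derivedESCG γmax F = e

/-- The summary causal graph (SCG) derived from an FTCG `F`. -/
def derivedSCG {V : Type*} (γmax : ℤ) (F : V × ℤ → V × ℤ → Prop) : V → V → Prop :=
  fun A B => ∃ t γ : ℤ, 0 ≤ γ ∧ γ ≤ γmax ∧ F (A, t - γ) (B, t)

/-- A candidate FTCG for an SCG `S`. -/
def CandidateSCG {V : Type*} (γmax : ℤ) (S : V → V → Prop)
    (F : V × ℤ → V × ℤ → Prop) : Prop :=
  TemporalPriority F ∧ MaxLag γmax F ∧ ConsistentThroughTime F ∧ Acyclic F ∧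
    derivedSCG γmax F = S

/-- The densest candidate FTCG for an ESCG `e`. -/
def densestFTCG {V : Type*} (γmax : ℤ) (e : (V ⊕ V) → (V ⊕ V) → Prop) :
    V × ℤ → V × ℤ → Prop :=
  fun p q =>
    (p.2 = q.2 ∧ e (Sum.inr p.1) (Sum.inr q.1)) ∨
    (∃ ℓ : ℤ, 1 ≤ ℓ ∧ ℓ ≤ γmax ∧ p.2 = q.2 - ℓ ∧ e (Sum.inl p.1) (Sum.inr q.1))

/-- The adjustment set `B_γ` for an ESCG `e`, variable `X`, time `t`, lag `γ`. -/
def Bset {V : Type*} (γmax : ℤ) (e : (V ⊕ V) → (V ⊕ V) → Prop)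
    (X : V) (t γ : ℤ) : Set (V × ℤ) :=
  {p | (∃ ℓ : ℤ, 1 ≤ ℓ ∧ ℓ ≤ γmax ∧ p.2 = t - γ - ℓ ∧ e (Sum.inl p.1) (Sum.inr X)) ∨
       (p.2 = t - γ ∧ e (Sum.inr p.1) (Sum.inr X))}

/-- The adjustment set `A_γ` for an SCG `S`, variable `X`, time `t`, lag `γ`. -/
def Aset {V : Type*} (γmax : ℤ) (S : V → V → Prop) (X : V) (t γ : ℤ) :
    Set (V × ℤ) :=
  {p | (∃ ℓ : ℤ, 1 ≤ ℓ ∧ ℓ ≤ γmax ∧ p.2 = t - γ - ℓ ∧ Anc S X p.1) ∨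
       (∃ ℓ : ℤ, 0 ≤ ℓ ∧ ℓ ≤ γmax ∧ p.2 = t - γ - ℓ ∧ ¬ Anc S X p.1)}

/-- `Z` satisfies the backdoor criterion over all candidate FTCGs (described
by the predicate `Cand`) relative to `(x, y)`. -/
def SatisfiesBackdoorCriterionAll {V : Type*}
    (Cand : (V × ℤ → V × ℤ → Prop) → Prop)
    (Z : Set (V × ℤ)) (x y : V × ℤ) : Prop :=
  x ∉ Z ∧ y ∉ Z ∧
    ∀ F, Cand F →
      (∀ π : DPath F, π.Between x y → π.Backdoor → Blocks Z π) ∧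
      (∀ p ∈ Z, ¬ Anc F x p)

/-- The standard backdoor criterion relative to `(x, y)` in a single directed
graph: no element of `Z` is a descendant of `x`, and `Z` blocks every
backdoor path between `x` and `y`. -/
def StdBackdoorCriterion {α : Type*} (E : α → α → Prop) (Z : Set α)
    (x y : α) : Prop :=
  (∀ p ∈ Z, ¬ Anc E x p) ∧
  (∀ π : DPath E, π.Between x y → π.Backdoor → Blocks Z π)

/-- The non-endpoint vertex at position `i` σ-blocks the path given the empty
set: the edge into it from its predecessor is present but not reversible, and
likewise from its successor. -/
def DPath.SigmaBlockedAt {α : Type*} {E : α → α → Prop} (π : DPath E) (i : ℕ) : Prop :=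
  0 < i ∧ i < π.n ∧
    (E (π.w (i - 1)) (π.w i) ∧ ¬ E (π.w i) (π.w (i - 1))) ∧
    (E (π.w (i + 1)) (π.w i) ∧ ¬ E (π.w i) (π.w (i + 1)))

/-- A path is σ-active given the empty set if no non-endpoint vertex
σ-blocks it. -/
def DPath.SigmaActive {α : Type*} {E : α → α → Prop} (π : DPath E) : Prop :=
  ∀ i, ¬ π.SigmaBlockedAt i

/-- A directed cycle: vertices `w 0, …, w (m-1)` pairwise distinct, with
`w m = w 0` and edges `w i → w (i+1)`; `m = 1` is a self-loop. -/
structure DCycle {α : Type*} (E : α → α → Prop) where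
  m : ℕ
  pos : 1 ≤ m
  w : ℕ → α
  ret : w m = w 0
  inj : ∀ i j, i < m → j < m → w i = w j → i = j
  valid : ∀ i, i < m → E (w i) (w (i + 1))

/-- The cycle passes through `x`. -/
def DCycle.Through {α : Type*} {E : α → α → Prop} (c : DCycle E) (x : α) : Prop :=
  ∃ i, i < c.m ∧ c.w i = x

/-- `Cycles^>(x, E) ≠ ∅`: there is a directed cycle through `x` with at least
two distinct vertices. -/
def HasBigCycleThrough {α : Type*} (E : α → α → Prop) (x : α) : Prop :=
  ∃ c : DCycle E, c.Through x ∧ 2 ≤ c.m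

/-- The graph obtained by removing vertex `y` and all incident edges. -/
def delVertex {α : Type*} (E : α → α → Prop) (y : α) : α → α → Prop :=
  fun a b => a ≠ y ∧ b ≠ y ∧ E a b

/-- The cycle is the 2-cycle `x ⇄ y`. -/
def DCycle.IsTwoCycle {α : Type*} {E : α → α → Prop} (c : DCycle E) (x y : α) : Prop :=
  c.m = 2 ∧ ((c.w 0 = x ∧ c.w 1 = y) ∨ (c.w 0 = y ∧ c.w 1 = x))

/-- `a` and `b` lie on a common directed cycle of `E`
(`b` lies on a directed cycle through `a`). -/
def OnCommonCycle {α : Type*} (E : α → α → Prop) (a b : α) : Prop :=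
  ∃ c : DCycle E, c.Through a ∧ c.Through b

/-- A path `πf` in a candidate FTCG is compatible with a path `πs` in the SCG
`S` if every intermediate vertex `(W, u)` of `πf` satisfies: `W` is an
intermediate vertex of `πs`, or `W` lies on a directed cycle of `S` through
some intermediate vertex of `πs` but on no directed cycle of `S` through `X`. -/
def Compatible {V : Type*} {F : V × ℤ → V × ℤ → Prop} (S : V → V → Prop) (X : V)
    (πf : DPath F) (πs : DPath S) : Prop :=
  ∀ i, 0 < i → i < πf.n →
    (∃ j, 0 < j ∧ j < πs.n ∧ πs.w j = (πf.w i).1) ∨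
    (∃ j, 0 < j ∧ j < πs.n ∧ OnCommonCycle S (πs.w j) (πf.w i).1 ∧
      ¬ OnCommonCycle S X (πf.w i).1)

/-- A path in a candidate FTCG between `(X, t−γ)` and `(Y, t)` is ambiguous if
all its vertices are at times `≥ t − γ`. -/
def DPath.Ambiguous {V : Type*} {F : V × ℤ → V × ℤ → Prop} (π : DPath F)
    (t γ : ℤ) : Prop :=
  ∀ i, i ≤ π.n → t - γ ≤ (π.w i).2

/-- Reachability is witnessed by a directed path with pairwise distinct vertices. -/
theorem exists_simple_path_of_reflTransGen {α : Type*} {E : α → α → Prop} {u v : α}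
    (h : Relation.ReflTransGen E u v) :
    ∃ (n : ℕ) (w : ℕ → α), w 0 = u ∧ w n = v ∧
      (∀ i j, i ≤ n → j ≤ n → w i = w j → i = j) ∧ ∀ i, i < n → E (w i) (w (i + 1)) := by
  induction h using Relation.ReflTransGen.head_induction_on with
  | refl => exact ⟨0, fun _ => v, rfl, rfl, by omega, by omega⟩
  | @head a c hac _ ih =>
    obtain ⟨n, w, hw0, hwn, hinj, hE⟩ := ih
    by_cases ha : ∃ j, j ≤ n ∧ w j = a
    · obtain ⟨j, hj, rfl⟩ := ha
      refine ⟨n - j, fun i => w (j + i), rfl, ?_, ?_, ?_⟩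
      · simpa [Nat.add_sub_cancel' hj] using hwn
      · intro i k hi hk hik
        have := hinj (j + i) (j + k) (by omega) (by omega) hik
        omega
      · intro i hi
        exact hE (j + i) (by omega)
    · push Not at ha
      refine ⟨n + 1, fun i => Nat.casesOn i a w, rfl, hwn, ?_, ?_⟩
      · rintro (_ | i) (_ | j) hi hj hij
        · rfl
        · exact absurd hij.symm (ha j (by omega))
        · exact absurd hij (ha i (by omega))
        · have := hinj i j (by omega) (by omega) hij
          omega
      · rintro (_ | i) hi
        · simpa [hw0] using hac
        · exact hE i (by omega)

/-- If `v` is not an ancestor of `w`, no directed path into `w` meets `v`. -/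
theorem reflTransGen_delVertex {α : Type*} {E : α → α → Prop} {u v w : α}
    (h : Relation.ReflTransGen E u w) (hv : ¬ Relation.ReflTransGen E v w) :
    Relation.ReflTransGen (delVertex E v) u w := by
  induction h using Relation.ReflTransGen.head_induction_on with
  | refl => exact .refl
  | head hac hcw ih =>
    refine .head ⟨?_, ?_, hac⟩ ih
    · rintro rfl
      exact hv (.head hac hcw)
    · rintro rfl
      exact hv hcw

/-- An edge `w → x` closing a directed path from `x` to `w ≠ x` gives a directed
cycle through `x` with at least two vertices. -/
theorem hasBigCycleThrough_of_reflTransGen {α : Type*} {E : α → α → Prop} {x w : α}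
    (h : Relation.ReflTransGen E x w) (hwx : E w x) (hne : w ≠ x) :
    HasBigCycleThrough E x := by
  obtain ⟨n, p, hp0, hpn, hinj, hE⟩ := exists_simple_path_of_reflTransGen h
  have hn : n ≠ 0 := by
    rintro rfl
    exact hne (hpn.symm.trans hp0)
  refine ⟨⟨n + 1, by omega, fun i => if i ≤ n then p i else x, by simp [hp0], ?_, ?_⟩,
    ⟨0, by simp, by simp [hp0]⟩, by simp; omega⟩
  · intro i j hi hj hij
    simp only [Nat.lt_succ_iff.mp hi, Nat.lt_succ_iff.mp hj, if_true] at hij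
    exact hinj i j (by omega) (by omega) hij
  · intro i hi
    rcases Nat.lt_succ_iff_lt_or_eq.mp hi with hi | rfl
    · simpa [hi.le, Nat.succ_le_of_lt hi] using hE i hi
    · simpa [hpn] using hwx

/-- A directed path from `y` to `x`, read backwards, is a σ-active backdoor path. -/
theorem exists_sigmaActive_backdoor_of_reflTransGen {α : Type*} {E : α → α → Prop} {x y : α}
    (h : Relation.ReflTransGen E y x) (hne : x ≠ y) (hxy : Relation.ReflTransGen E x y) :
    ∃ π : DPath E, π.Between x y ∧ π.Backdoor ∧ π.SigmaActive ∧
      ∀ i, 0 < i → i < π.n → Anc E x (π.w i) := by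
  obtain ⟨n, p, hp0, hpn, hinj, hE⟩ := exists_simple_path_of_reflTransGen h
  have hn : n ≠ 0 := by
    rintro rfl
    exact hne (hpn.symm.trans hp0)
  have hback : ∀ i, i < n → E (p (n - (i + 1))) (p (n - i)) := by
    intro i hi
    have := hE (n - (i + 1)) (by omega)
    rwa [show n - (i + 1) + 1 = n - i by omega] at this
  have hreach : ∀ i, i ≤ n → Relation.ReflTransGen E y (p i) := by
    intro i
    induction i with
    | zero => intro _; rw [hp0]
    | succ i ih => intro hi; exact (ih (by omega)).tail (hE i (by omega))
  refine ⟨⟨n, by omega, fun i => p (n - i), fun _ => false, ?_, ?_⟩,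
    ⟨by simpa using hpn, by simpa using hp0⟩, rfl, ?_, ?_⟩
  · intro i j hi hj hij
    have := hinj (n - i) (n - j) (by omega) (by omega) hij
    omega
  · intro i hi
    exact ⟨by simp, fun _ => hback i hi⟩
  · rintro i ⟨hi0, hin, ⟨-, hno⟩, -⟩
    have := hback (i - 1) (by simp only at hin; omega)
    rw [show i - 1 + 1 = i by omega] at this
    exact hno this
  · intro i _ _
    exact hxy.trans (hreach (n - i) (by omega))

theorem TemporalPriority.le {V : Type*} {F : V × ℤ → V × ℤ → Prop} (h : TemporalPriority F)
    {p q : V × ℤ} (hpq : F p q) : p.2 ≤ q.2 :=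
  (h p.1 q.1 p.2 q.2 hpq).1

theorem TemporalPriority.le_of_anc {V : Type*} {F : V × ℤ → V × ℤ → Prop}
    (h : TemporalPriority F) {p q : V × ℤ} (hpq : Anc F p q) : p.2 ≤ q.2 := by
  induction hpq with
  | refl => exact le_rfl
  | tail _ hbc ih => exact ih.trans (h.le hbc)

theorem CandidateSCG.edge {V : Type*} {γmax : ℤ} {S : V → V → Prop}
    {F : V × ℤ → V × ℤ → Prop} (h : CandidateSCG γmax S F) {p q : V × ℤ} (hpq : F p q) :
    S p.1 q.1 := by
  obtain ⟨hT, hM, -, -, rfl⟩ := h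
  refine ⟨q.2, q.2 - p.2, sub_nonneg.mpr (hT.le hpq), hM p.1 q.1 p.2 q.2 hpq, ?_⟩
  simpa using hpq

theorem CandidateSCG.anc {V : Type*} {γmax : ℤ} {S : V → V → Prop}
    {F : V × ℤ → V × ℤ → Prop} (h : CandidateSCG γmax S F) {p q : V × ℤ} (hpq : Anc F p q) :
    Anc S p.1 q.1 := by
  induction hpq with
  | refl => exact .refl
  | tail _ hbc ih => exact ih.tail (h.edge hbc)

/-- Descendants of instances of descendants of `X` at time at least `t - γ` avoid `Aset`. -/
theorem CandidateSCG.not_anc_of_mem_Aset {V : Type*} {γmax : ℤ} {S : V → V → Prop}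
    {F : V × ℤ → V × ℤ → Prop} (h : CandidateSCG γmax S F) {X : V} {t γ : ℤ} {p z : V × ℤ}
    (hX : Anc S X p.1) (hp : t - γ ≤ p.2) (hz : z ∈ Aset γmax S X t γ) : ¬ Anc F p z := by
  intro hpz
  have hle := h.1.le_of_anc hpz
  rcases hz with ⟨ℓ, h1, -, h2, -⟩ | ⟨_, -, -, -, hno⟩
  · omega
  · exact hno (hX.trans (h.anc hpz))

/-- A path not blocked by `Aset` whose endpoints are not before time `t - γ` stays
at times at least `t - γ`. -/
theorem CandidateSCG.ambiguous_of_not_blocks {V : Type*} {γmax : ℤ} {S : V → V → Prop}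
    {F : V × ℤ → V × ℤ → Prop} (h : CandidateSCG γmax S F) {X : V} {t γ : ℤ} (π : DPath F)
    (h0 : t - γ ≤ (π.w 0).2) (hn : t - γ ≤ (π.w π.n).2)
    (hb : ¬ Blocks (Aset γmax S X t γ) π) : π.Ambiguous t γ := by
  intro i
  induction i with
  | zero => intro _; exact h0
  | succ i ih =>
    intro hi
    have hprev := ih (by omega)
    by_contra hlt
    have hin : i + 1 ≠ π.n := fun he => hlt (he ▸ hn)
    obtain ⟨hfwd, hbwd⟩ := π.valid i (by omega)
    cases hd : π.dir i with
    | true => exact hlt (hprev.trans (h.1.le (hfwd hd)))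
    | false =>
      have hlag : (π.w i).2 - (π.w (i + 1)).2 ≤ γmax := h.2.1 _ _ _ _ (hbwd hd)
      refine hb (.inl ⟨i + 1, ⟨by omega, by omega, .inl (by simpa using hd)⟩, ?_⟩)
      by_cases hX : Anc S X (π.w (i + 1)).1
      · exact .inl ⟨t - γ - (π.w (i + 1)).2, by omega, by omega, by omega, hX⟩
      · exact .inr ⟨t - γ - (π.w (i + 1)).2, by omega, by omega, by omega, hX⟩

/-- On a path from `(X, t - γ)` not blocked by `Aset`
and staying at times at least `t - γ`, every vertex is an instance of
a descendant of `X`, there is no collider, and the source of a backward step lies at time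
`t - γ`. -/
theorem CandidateSCG.descendants_of_not_blocks {V : Type*} {γmax : ℤ} (hγmax : 1 ≤ γmax)
    {S : V → V → Prop} {F : V × ℤ → V × ℤ → Prop} (h : CandidateSCG γmax S F) {X Y : V}
    (hanc : Anc S X Y) {t γ : ℤ} (π : DPath F) (hπ : π.Between (X, t - γ) (Y, t))
    (ham : π.Ambiguous t γ) (hb : ¬ Blocks (Aset γmax S X t γ) π) :
    (∀ i, ¬ π.ColliderAt i) ∧
      ∀ i, i ≤ π.n → Anc S X (π.w i).1 ∧ (0 < i → π.dir (i - 1) = false → (π.w i).2 = t - γ) := by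
  obtain ⟨hs, he⟩ := hπ
  have hcol : ∀ i, Anc S X (π.w i).1 → ¬ π.ColliderAt i := fun i hX hc =>
    hb (.inr ⟨i, hc, fun _ hz => h.not_anc_of_mem_Aset hX (ham i hc.2.1.le) hz⟩)
  have key : ∀ i, i ≤ π.n →
      Anc S X (π.w i).1 ∧ (0 < i → π.dir (i - 1) = false → (π.w i).2 = t - γ) := by
    intro i
    induction i with
    | zero => intro _; exact ⟨by rw [hs]; exact .refl, by omega⟩
    | succ i ih =>
      intro hi
      obtain ⟨hX, htime⟩ := ih (by omega)
      obtain ⟨hfwd, hbwd⟩ := π.valid i (by omega)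
      cases hd : π.dir i with
      | true => exact ⟨hX.tail (h.edge (hfwd hd)), by simp [hd]⟩
      | false =>
        have hti : (π.w i).2 = t - γ := by
          rcases Nat.eq_zero_or_pos i with rfl | hpos
          · rw [hs]
          · refine htime hpos ?_
            by_contra hne
            exact hcol i hX ⟨hpos, by omega, by simpa using hne, hd⟩
        have ht : (π.w (i + 1)).2 = t - γ :=
          le_antisymm ((h.1.le (hbwd hd)).trans hti.le) (ham _ hi)
        refine ⟨?_, fun _ _ => ht⟩
        by_contra hno
        have hin : i + 1 ≠ π.n := by
          intro hin
          rw [hin, he] at hno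
          exact hno hanc
        exact hb (.inl ⟨i + 1, ⟨by omega, by omega, .inl (by simpa using hd)⟩,
          .inr ⟨0, le_rfl, by omega, by omega, hno⟩⟩)
  exact ⟨fun i hc => hcol i (key i hc.2.1.le).1 hc, key⟩

/-- A collider-free path all of whose vertices share the same time projects to a σ-active path
in the summary graph. -/
theorem CandidateSCG.exists_sigmaActive_of_const_time {V : Type*} {γmax : ℤ}
    {S : V → V → Prop} {F : V × ℤ → V × ℤ → Prop} (h : CandidateSCG γmax S F) (π : DPath F)
    {t : ℤ} (htime : ∀ i, i ≤ π.n → (π.w i).2 = t) (hcol : ∀ i, ¬ π.ColliderAt i) :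
    ∃ πs : DPath S, πs.n = π.n ∧ (∀ i, πs.w i = (π.w i).1) ∧ πs.dir = π.dir ∧
      πs.SigmaActive := by
  have hvalid : ∀ i, i < π.n → (π.dir i = true → S (π.w i).1 (π.w (i + 1)).1) ∧
      (π.dir i = false → S (π.w (i + 1)).1 (π.w i).1) := fun i hi =>
    ⟨fun hd => h.edge ((π.valid i hi).1 hd), fun hd => h.edge ((π.valid i hi).2 hd)⟩
  refine ⟨⟨π.n, π.pos, fun i => (π.w i).1, π.dir, ?_, hvalid⟩, rfl, fun _ => rfl, rfl, ?_⟩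
  · intro i j hi hj hij
    exact π.inj i j hi hj (Prod.ext hij ((htime i hi).trans (htime j hj).symm))
  · rintro i ⟨hi0, hin, ⟨-, hl⟩, -, hr⟩
    simp only at hin hl hr
    refine hcol i ⟨hi0, hin, ?_, ?_⟩
    · by_contra hd
      have := (hvalid (i - 1) (by omega)).2 (by simpa using hd)
      rw [show i - 1 + 1 = i by omega] at this
      exact hl this
    · by_contra hd
      exact hr ((hvalid i hin).1 (by simpa using hd))

/-- On a collider-free path, a vertex left along a forward edge is no later than the endpoint. -/
theorem TemporalPriority.le_end_of_dir {V : Type*} {F : V × ℤ → V × ℤ → Prop}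
    (h : TemporalPriority F) (π : DPath F) (hcol : ∀ i, ¬ π.ColliderAt i) {i : ℕ} (hi : i ≤ π.n)
    (hd : i < π.n → π.dir i = true) : (π.w i).2 ≤ (π.w π.n).2 := by
  induction hi using Nat.decreasingInduction with
  | self => exact le_rfl
  | of_succ k hk ih =>
    refine (h.le ((π.valid k hk).1 (hd hk))).trans (ih fun hk' => ?_)
    by_contra hne
    exact hcol (k + 1) ⟨by omega, hk', hd hk, by simpa using hne⟩

/-- Lemma 2, graph-theoretic form: under conditions (i) and
(ii), the set `A_γ` satisfies the backdoor criterion over all candidate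
FTCGs relative to `((X, t−γ), (Y, t))`. -/
theorem lemma2_Aset_backdoor_criterion {V : Type*} [Fintype V] [Nonempty V]
    (γmax : ℤ) (hγmax : 1 ≤ γmax)
    (S : V → V → Prop) (X Y : V) (hXY : X ≠ Y) (hanc : Anc S X Y)
    (t γ : ℤ) (hγ : 0 ≤ γ)
    (h1 : γ = 0 ∨ ¬ HasBigCycleThrough (delVertex S Y) X)
    (h2 : ¬ ∃ πs : DPath S, πs.Between X Y ∧ πs.Backdoor ∧ πs.SigmaActive ∧
        ∀ i, 0 < i → i < πs.n → Anc S X (πs.w i)) :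
    SatisfiesBackdoorCriterionAll (CandidateSCG γmax S)
      (Aset γmax S X t γ) (X, t - γ) (Y, t) := by
  refine ⟨?_, ?_, fun F hF => ⟨fun π hπ hbd => ?_, fun p hp =>
    hF.not_anc_of_mem_Aset .refl le_rfl hp⟩⟩
  · rintro (⟨ℓ, hℓ, -, he, -⟩ | ⟨_, -, -, -, hno⟩)
    · simp only at he
      omega
    · exact hno .refl
  · rintro (⟨ℓ, hℓ, -, he, -⟩ | ⟨_, -, -, -, hno⟩)
    · simp only at he
      omega
    · exact hno hanc
  by_contra hb
  have hYX : ¬ Anc S Y X := fun h =>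
    h2 (exists_sigmaActive_backdoor_of_reflTransGen h hXY hanc)
  have hs : π.w 0 = (X, t - γ) := hπ.1
  have he : π.w π.n = (Y, t) := hπ.2
  have ham : π.Ambiguous t γ :=
    hF.ambiguous_of_not_blocks π (by rw [hs]) (by rw [he]; simpa using hγ) hb
  obtain ⟨hcol, hstr⟩ := hF.descendants_of_not_blocks hγmax hanc π hπ ham hb
  rcases h1 with rfl | h1
  · have htime : ∀ i, i ≤ π.n → (π.w i).2 = t := by
      intro i hi
      have hge := ham i hi
      by_cases hd : i < π.n → π.dir i = true
      · have hle := hF.1.le_end_of_dir π hcol hi hd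
        rw [he] at hle
        simp only at hle
        omega
      · push Not at hd
        rcases Nat.eq_zero_or_pos i with rfl | hpos
        · simp [hs]
        · have := (hstr i hi).2 hpos (by
            by_contra hne
            exact hcol i ⟨hpos, hd.1, by simpa using hne, by simpa using hd.2⟩)
          omega
    obtain ⟨πs, hn, hw, hdir, hact⟩ := hF.exists_sigmaActive_of_const_time π htime hcol
    refine h2 ⟨πs, ⟨by rw [hw, hs], by rw [hw, hn, he]⟩, ?_, hact, fun i _ hi => ?_⟩
    · simpa [DPath.Backdoor, hdir] using hbd
    · rw [hw]
      exact (hstr i (by omega)).1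
  · have hedge : F (π.w 1) (X, t - γ) := hs ▸ (π.valid 0 π.pos).2 hbd
    have hWX : S (π.w 1).1 X := hF.edge hedge
    have hne : (π.w 1).1 ≠ X := by
      intro hWeq
      have hlt : (π.w 1).2 < t - γ := (hF.1 _ _ _ _ hedge).2 hWeq
      have := ham 1 π.pos
      omega
    have hYW : ¬ Anc S Y (π.w 1).1 := fun h => hYX (h.tail hWX)
    refine h1 (hasBigCycleThrough_of_reflTransGen
      (reflTransGen_delVertex (hstr 1 π.pos).1 hYW) ⟨?_, hXY, hWX⟩ hne)
    intro hWY
    exact hYW (hWY ▸ .refl)
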